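/- Let L be a balanced necklace with n red and n blue beads, and for an integer i ≥ 1 let L_i be the necklace on 2in beads obtained from L by replacing every bead with i consecutive beads of the same color. Then the maximum number of beads covered by a proper heterogeneous matching of L_i equals i times the maximum number of beads covered by a proper heterogeneous matching of L; moreover, mono(L_i) = mono(L). -/

import Mathlib

def strictBtw {N : ℕ} (a x b : Fin N) : Prop :=
  0 < (x - a).val ∧ (x - a).val < (b - a).val

def Crosses {N : ℕ} (p q : Fin N × Fin N) : Prop :=
  (strictBtw p.1 q.1 p.2 ∧ strictBtw p.2 q.2 p.1) ∨
  (strictBtw p.1 q.2 p.2 ∧ strictBtw p.2 q.1 p.1)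

def IsMatching {N : ℕ} (M : Finset (Fin N × Fin N)) : Prop :=
  (∀ p ∈ M, p.1 ≠ p.2) ∧
  ∀ p ∈ M, ∀ q ∈ M, p ≠ q →
    p.1 ≠ q.1 ∧ p.1 ≠ q.2 ∧ p.2 ≠ q.1 ∧ p.2 ≠ q.2

def CrossFree {N : ℕ} (M : Finset (Fin N × Fin N)) : Prop :=
  ∀ p ∈ M, ∀ q ∈ M, ¬ Crosses p q

def InArc {N : ℕ} (k : Fin N) (m : ℕ) (x : Fin N) : Prop :=
  (x - k).val < m

def RespectsSecant {N : ℕ} (M : Finset (Fin N × Fin N)) (k : Fin N) (m : ℕ) : Prop :=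
  0 < m ∧ m < N ∧ ∀ p ∈ M, Xor' (InArc k m p.1) (InArc k m p.2)

def SecantRespecting {N : ℕ} (M : Finset (Fin N × Fin N)) : Prop :=
  ∃ k m, RespectsSecant M k m

def IsProper {N : ℕ} (M : Finset (Fin N × Fin N)) : Prop :=
  CrossFree M ∧ SecantRespecting M

def Heterogeneous {N : ℕ} (c : Fin N → Bool) (M : Finset (Fin N × Fin N)) : Prop :=
  ∀ p ∈ M, c p.1 ≠ c p.2

def Homogeneous {N : ℕ} (c : Fin N → Bool) (M : Finset (Fin N × Fin N)) : Prop :=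
  ∀ p ∈ M, c p.1 = c p.2

def redCount {N : ℕ} (c : Fin N → Bool) : ℕ :=
  (Finset.univ.filter fun i => c i = true).card

def monoCount {N : ℕ} (c : Fin N → Bool) : ℕ :=
  (Finset.univ.filter fun i : Fin N =>
    c i ≠ c ⟨(i.val + 1) % N, Nat.mod_lt _ i.pos⟩).card

/-- Blow-up of a necklace: each bead is replaced by i consecutive beads of the
same color. -/
def blowup {N : ℕ} (i : ℕ) (c : Fin N → Bool) : Fin (i * N) → Bool :=
  fun x => c ⟨x.val / i, Nat.div_lt_of_lt_mul x.isLt⟩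

theorem Fin.val_sub_eq_ite {N : ℕ} (x a : Fin N) :
    (x - a).val = if a.val ≤ x.val then x.val - a.val else N + x.val - a.val := by
  have hx := x.isLt
  have ha := a.isLt
  rw [Fin.val_sub]
  split_ifs with h
  · rw [show N - a.val + x.val = (x.val - a.val) + N by omega, Nat.add_mod_right,
      Nat.mod_eq_of_lt (by omega)]
  · rw [Nat.mod_eq_of_lt (by omega)]
    omega

theorem strictBtw_iff {N : ℕ} (a x b : Fin N) :
    strictBtw a x b ↔ (a.val < x.val ∧ x.val < b.val) ∨ (b.val < a.val ∧ a.val < x.val) ∨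
      (x.val < b.val ∧ b.val < a.val) := by
  have hx := x.isLt
  have ha := a.isLt
  have hb := b.isLt
  unfold strictBtw
  rw [Fin.val_sub_eq_ite, Fin.val_sub_eq_ite]
  split_ifs <;> omega

theorem strictBtw_sub_right_iff {N : ℕ} (a x b k : Fin N) :
    strictBtw (a - k) (x - k) (b - k) ↔ strictBtw a x b := by
  have hx := x.isLt
  have ha := a.isLt
  have hb := b.isLt
  have hk := k.isLt
  rw [strictBtw_iff, strictBtw_iff]
  simp only [Fin.val_sub_eq_ite]
  split_ifs <;> omega

theorem crosses_sub_right_iff {N : ℕ} (p q : Fin N × Fin N) (k : Fin N) :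
    Crosses (p.1 - k, p.2 - k) (q.1 - k, q.2 - k) ↔ Crosses p q := by
  simp only [Crosses, strictBtw_sub_right_iff]

theorem crosses_swap_left_iff {N : ℕ} (p q : Fin N × Fin N) :
    Crosses p.swap q ↔ Crosses p q := by
  simp only [Crosses, Prod.fst_swap, Prod.snd_swap]
  tauto

theorem crosses_swap_right_iff {N : ℕ} (p q : Fin N × Fin N) :
    Crosses p q.swap ↔ Crosses p q := by
  simp only [Crosses, Prod.fst_swap, Prod.snd_swap]
  tauto

/-- The bead of the original necklace that a bead of the blow-up comes from. -/
def blockOf {N i : ℕ} (x : Fin (i * N)) : Fin N :=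
  ⟨x.val / i, Nat.div_lt_of_lt_mul x.isLt⟩

theorem lt_of_blockOf_lt {N i : ℕ} {x y : Fin (i * N)}
    (h : (blockOf x).val < (blockOf y).val) : x.val < y.val := by
  by_contra! hle
  exact absurd (Nat.div_le_div_right (c := i) hle) (not_le.mpr h)

theorem blockOf_le_of_le {N i : ℕ} {x y : Fin (i * N)} (h : x.val ≤ y.val) :
    (blockOf x).val ≤ (blockOf y).val :=
  Nat.div_le_div_right h

theorem strictBtw_of_blockOf {N i : ℕ} {a x b : Fin (i * N)}
    (h : strictBtw (blockOf a) (blockOf x) (blockOf b)) : strictBtw a x b := by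
  rw [strictBtw_iff] at h ⊢
  rcases h with ⟨h, h'⟩ | ⟨h, h'⟩ | ⟨h, h'⟩ <;>
    have := lt_of_blockOf_lt h <;> have := lt_of_blockOf_lt h' <;> omega

theorem blockOf_strictBtw {N i : ℕ} {a x b : Fin (i * N)} (h : strictBtw a x b)
    (hax : blockOf a ≠ blockOf x) (hxb : blockOf x ≠ blockOf b) (hab : blockOf a ≠ blockOf b) :
    strictBtw (blockOf a) (blockOf x) (blockOf b) := by
  rw [Ne, Fin.ext_iff] at hax hxb hab
  rw [strictBtw_iff] at h ⊢
  rcases h with ⟨h, h'⟩ | ⟨h, h'⟩ | ⟨h, h'⟩ <;>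
    have := blockOf_le_of_le h.le <;> have := blockOf_le_of_le h'.le <;> omega

theorem crosses_of_blockOf {N i : ℕ} {p q : Fin (i * N) × Fin (i * N)}
    (h : Crosses (blockOf p.1, blockOf p.2) (blockOf q.1, blockOf q.2)) : Crosses p q :=
  h.imp (fun h => ⟨strictBtw_of_blockOf h.1, strictBtw_of_blockOf h.2⟩)
    (fun h => ⟨strictBtw_of_blockOf h.1, strictBtw_of_blockOf h.2⟩)

/-- The `j`-th bead of the block that replaces `a`. -/
def beadOf {N i : ℕ} (a : Fin N) (j : Fin i) : Fin (i * N) :=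
  ⟨i * a.val + j.val, by
    have := Nat.mul_le_mul_left i (Nat.succ_le_of_lt a.isLt)
    have := j.isLt
    rw [Nat.mul_succ] at *
    omega⟩

theorem blockOf_beadOf {N i : ℕ} (a : Fin N) (j : Fin i) : blockOf (beadOf a j) = a := by
  have hj := j.isLt
  ext
  change (i * a.val + j.val) / i = a.val
  rw [Nat.mul_add_div (by omega), Nat.div_eq_of_lt hj, add_zero]

theorem inArc_beadOf_iff {N i : ℕ} (hi : 0 < i) (k : Fin N) (m : ℕ) (a : Fin N) (j : Fin i) :
    InArc (beadOf k ⟨0, hi⟩) (i * m) (beadOf a j) ↔ InArc k m a := by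
  have hj := j.isLt
  have hval : (beadOf a j - beadOf k ⟨0, hi⟩).val = i * (a - k).val + j.val := by
    rw [Fin.val_sub_eq_ite, Fin.val_sub_eq_ite]
    simp only [beadOf, add_zero]
    by_cases h : k.val ≤ a.val
    · have h' := Nat.mul_le_mul_left i h
      rw [if_pos (by omega), if_pos h, Nat.mul_sub]
      omega
    · have h' := Nat.mul_le_mul_left i (Nat.succ_le_of_lt (not_le.mp h))
      have hk := Nat.mul_le_mul_left i k.isLt.le
      rw [Nat.mul_succ] at h'
      rw [if_neg (by omega), if_neg h, Nat.mul_sub, Nat.mul_add]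
      omega
  unfold InArc
  rw [hval]
  constructor
  · intro h
    by_contra! hle
    have := Nat.mul_le_mul_left i hle
    omega
  · intro h
    have := Nat.mul_le_mul_left i (Nat.succ_le_of_lt h)
    rw [Nat.mul_succ] at this
    omega

/-- The `j`-th of the `i` parallel copies of a pair in the blow-up. -/
def pairCopy {N i : ℕ} (x : (Fin N × Fin N) × Fin i) : Fin (i * N) × Fin (i * N) :=
  (beadOf x.1.1 x.2, beadOf x.1.2 x.2.rev)

theorem beadOf_injective {N i : ℕ} {a b : Fin N} {j l : Fin i} (h : beadOf a j = beadOf b l) :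
    a = b ∧ j = l := by
  have hab : a = b := by rw [← blockOf_beadOf a j, h, blockOf_beadOf]
  subst hab
  refine ⟨rfl, ?_⟩
  have := congrArg Fin.val h
  simp only [beadOf] at this
  ext
  omega

theorem pairCopy_injective {N i : ℕ} :
    Function.Injective (pairCopy : (Fin N × Fin N) × Fin i → _) := by
  rintro ⟨⟨a, b⟩, j⟩ ⟨⟨a', b'⟩, j'⟩ h
  have h1 := beadOf_injective (congrArg Prod.fst h)
  have h2 := beadOf_injective (congrArg Prod.snd h)
  simp only at h1 h2
  simp [h1.1, h1.2, h2.1]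

theorem not_crosses_pairCopy_of_eq {N i : ℕ} {p : Fin N × Fin N} (hp : p.1 ≠ p.2)
    (j l : Fin i) : ¬ Crosses (pairCopy (p, j)) (pairCopy (p, l)) := by
  have hj := j.isLt
  have hl := l.isLt
  have hlt : p.1.val < p.2.val ∨ p.2.val < p.1.val := by
    rw [Ne, Fin.ext_iff] at hp
    omega
  simp only [Crosses, strictBtw_iff, pairCopy, beadOf, Fin.val_rev]
  rcases hlt with h | h <;> have := Nat.mul_le_mul_left i (Nat.succ_le_of_lt h) <;>
    rw [Nat.mul_succ] at this <;> omega

theorem exists_blowup_matching {N i : ℕ} (hi : 0 < i) (c : Fin N → Bool)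
    {M : Finset (Fin N × Fin N)} (hM : IsMatching M) (hP : IsProper M) (hH : Heterogeneous c M) :
    ∃ M' : Finset (Fin (i * N) × Fin (i * N)), IsMatching M' ∧ IsProper M' ∧
      Heterogeneous (blowup i c) M' ∧ M'.card = i * M.card := by
  obtain ⟨hcf, k, m, hm0, hmN, hsec⟩ := hP
  refine ⟨(M ×ˢ (Finset.univ : Finset (Fin i))).image pairCopy, ⟨?_, ?_⟩, ⟨?_, ?_⟩, ?_, ?_⟩
  · simp only [Finset.mem_image, Finset.mem_product, Finset.mem_univ, and_true]
    rintro _ ⟨⟨p, j⟩, hp, rfl⟩ h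
    exact hM.1 p hp (beadOf_injective h).1
  · simp only [Finset.mem_image, Finset.mem_product, Finset.mem_univ, and_true]
    rintro _ ⟨⟨p, j⟩, hp, rfl⟩ _ ⟨⟨q, l⟩, hq, rfl⟩ hne
    by_cases hpq : p = q
    · subst hpq
      have hjl : j ≠ l := fun h => hne (by rw [h])
      exact ⟨fun h => hjl (beadOf_injective h).2, fun h => hM.1 p hp (beadOf_injective h).1,
        fun h => hM.1 p hp (beadOf_injective h).1.symm,
        fun h => hjl (Fin.rev_injective (beadOf_injective h).2)⟩
    · obtain ⟨h1, h2, h3, h4⟩ := hM.2 p hp q hq hpq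
      exact ⟨fun h => h1 (beadOf_injective h).1, fun h => h2 (beadOf_injective h).1,
        fun h => h3 (beadOf_injective h).1, fun h => h4 (beadOf_injective h).1⟩
  · unfold CrossFree
    simp only [Finset.mem_image, Finset.mem_product, Finset.mem_univ, and_true]
    rintro _ ⟨⟨p, j⟩, hp, rfl⟩ _ ⟨⟨q, l⟩, hq, rfl⟩
    by_cases hpq : p = q
    · subst hpq
      exact not_crosses_pairCopy_of_eq (hM.1 p hp) j l
    · obtain ⟨h1, h2, h3, h4⟩ := hM.2 p hp q hq hpq
      have hp' := hM.1 p hp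
      intro h
      apply hcf p hp q hq
      refine h.imp ?_ ?_
      all_goals
        rintro ⟨h, h'⟩
        have e := blockOf_strictBtw h
        have e' := blockOf_strictBtw h'
        simp only [pairCopy, blockOf_beadOf] at e e'
        tauto
  · refine ⟨beadOf k ⟨0, hi⟩, i * m, Nat.mul_pos hi hm0, Nat.mul_lt_mul_of_pos_left hmN hi, ?_⟩
    simp only [Finset.mem_image, Finset.mem_product, Finset.mem_univ, and_true]
    rintro _ ⟨⟨p, j⟩, hp, rfl⟩
    simp only [pairCopy, inArc_beadOf_iff]
    exact hsec p hp
  · unfold Heterogeneous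
    simp only [Finset.mem_image, Finset.mem_product, Finset.mem_univ, and_true]
    rintro _ ⟨⟨p, j⟩, hp, rfl⟩
    change c (blockOf (beadOf _ _)) ≠ c (blockOf (beadOf _ _))
    rw [blockOf_beadOf, blockOf_beadOf]
    exact hH p hp
  · rw [Finset.card_image_of_injective _ pairCopy_injective, Finset.card_product,
      Finset.card_univ, Fintype.card_fin, mul_comm]

/-- The pairs of a matching that respects a secant can be listed in the order in which they meet
the secant, each oriented from the first arc to the second. -/
theorem exists_ordered_enumeration {N : ℕ} {M : Finset (Fin N × Fin N)} (hM : IsMatching M)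
    (hcf : CrossFree M) {k : Fin N} {m : ℕ} (hsec : RespectsSecant M k m) :
    ∃ e : Fin M.card → Fin N × Fin N,
      (∀ t, e t ∈ M ∨ (e t).swap ∈ M) ∧
      (∀ s t, s < t → ((e s).1 - k).val < ((e t).1 - k).val ∧
        ((e t).1 - k).val < ((e t).2 - k).val ∧ ((e t).2 - k).val < ((e s).2 - k).val) := by
  classical
  let o : Fin N × Fin N → Fin N × Fin N := fun p => if InArc k m p.1 then p else p.swap
  have ho : ∀ p, o p = p ∨ o p = p.swap := fun p => by
    by_cases h : InArc k m p.1 <;> simp [o, h]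
  have harc : ∀ p ∈ M, InArc k m (o p).1 ∧ ¬ InArc k m (o p).2 := fun p hp => by
    rcases hsec.2.2 p hp with ⟨h1, h2⟩ | ⟨h1, h2⟩ <;> simp [o, h1, h2]
  have hdisj : ∀ p ∈ M, ∀ q ∈ M, p ≠ q → (o p).1 ≠ (o q).1 ∧ (o p).2 ≠ (o q).2 := by
    intro p hp q hq hpq
    obtain ⟨h1, h2, h3, h4⟩ := hM.2 p hp q hq hpq
    rcases ho p with h | h <;> rcases ho q with h' | h' <;> rw [h, h'] <;>
      exact ⟨by assumption, by assumption⟩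
  have hnc : ∀ p ∈ M, ∀ q ∈ M, ¬ Crosses (o p) (o q) := by
    intro p hp q hq
    rcases ho p with h | h <;> rcases ho q with h' | h' <;> rw [h, h'] <;>
      simpa only [crosses_swap_left_iff, crosses_swap_right_iff] using hcf p hp q hq
  let key : Fin N × Fin N → ℕ := fun p => ((o p).1 - k).val
  have hsub : ∀ a b : Fin N, (a - k).val = (b - k).val → a = b := by
    intro a b h
    have := a.isLt
    have := b.isLt
    have := k.isLt
    rw [Fin.val_sub_eq_ite, Fin.val_sub_eq_ite] at h
    ext
    split_ifs at h <;> omega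
  have hkey : Set.InjOn key M := by
    intro p hp q hq h
    by_contra hpq
    exact (hdisj p hp q hq hpq).1 (hsub _ _ h)
  have hcard : (M.image key).card = M.card := Finset.card_image_of_injOn hkey
  let f := (M.image key).orderEmbOfFin hcard
  have hf : ∀ t, ∃ p ∈ M, key p = f t := fun t =>
    Finset.mem_image.mp ((M.image key).orderEmbOfFin_mem hcard t)
  choose g hgM hg using hf
  refine ⟨fun t => o (g t), fun t => ?_, fun s t hst => ?_⟩
  · rcases ho (g t) with h | h
    · left; simpa only [h] using hgM t
    · right; simpa only [h, Prod.swap_swap] using hgM t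
  · have hlt : ((o (g s)).1 - k).val < ((o (g t)).1 - k).val := by
      have := f.strictMono hst
      rwa [← hg, ← hg] at this
    have hne : g s ≠ g t := fun h => by rw [h] at hlt; exact lt_irrefl _ hlt
    have h2 : ((o (g s)).2 - k).val ≠ ((o (g t)).2 - k).val := fun h =>
      (hdisj _ (hgM s) _ (hgM t) hne).2 (hsub _ _ h)
    have hc := hnc _ (hgM s) _ (hgM t)
    rw [← crosses_sub_right_iff _ _ k] at hc
    simp only [Crosses, strictBtw_iff] at hc
    have hs := harc _ (hgM s)
    have ht := harc _ (hgM t)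
    simp only [InArc] at hs ht
    dsimp only
    omega

/-- Of three nested pairs, the middle one meets every block that meets both others. -/
theorem blockOf_eq_of_nested {N i : ℕ} {s g t : Fin (i * N) × Fin (i * N)} {k : Fin (i * N)}
    (o1 : (s.1 - k).val < (g.1 - k).val ∧ (g.1 - k).val < (g.2 - k).val ∧
      (g.2 - k).val < (s.2 - k).val)
    (o2 : (g.1 - k).val < (t.1 - k).val ∧ (t.1 - k).val < (t.2 - k).val ∧
      (t.2 - k).val < (g.2 - k).val)
    {x y : Fin (i * N)} (hx : x = s.1 ∨ x = s.2) (hy : y = t.1 ∨ y = t.2)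
    (hxy : blockOf x = blockOf y) : blockOf g.1 = blockOf x ∨ blockOf g.2 = blockOf x := by
  have between : ∀ z : Fin (i * N), (x.val ≤ z.val ∧ z.val ≤ y.val ∨
      y.val ≤ z.val ∧ z.val ≤ x.val) → blockOf z = blockOf x := by
    intro z hz
    rw [Fin.ext_iff] at hxy ⊢
    rcases hz with ⟨h, h'⟩ | ⟨h, h'⟩ <;> have := blockOf_le_of_le h <;>
      have := blockOf_le_of_le h' <;> omega
  have hkl := k.isLt
  have b1 := s.1.isLt
  have b2 := s.2.isLt
  have b3 := g.1.isLt
  have b4 := g.2.isLt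
  have b5 := t.1.isLt
  have b6 := t.2.isLt
  simp only [Fin.val_sub_eq_ite] at o1 o2
  by_contra! hcon
  have c1 := mt (between g.1) hcon.1
  have c2 := mt (between g.2) hcon.2
  rcases hx with rfl | rfl <;> rcases hy with rfl | rfl <;>
    split_ifs at o1 o2 <;> omega

/-- Nested pairs whose ends lie in different blocks respect a common secant after every block is
contracted to one bead. -/
theorem secantRespecting_image_blockOf {N i r : ℕ} (hr : 0 < r) {k : Fin (i * N)}
    {d : Fin r → Fin (i * N) × Fin (i * N)}
    (hdo : ∀ s t, s < t → ((d s).1 - k).val < ((d t).1 - k).val ∧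
      ((d t).1 - k).val < ((d t).2 - k).val ∧ ((d t).2 - k).val < ((d s).2 - k).val)
    (hdd : ∀ s t, s ≠ t → blockOf (d s).1 ≠ blockOf (d t).1 ∧
      blockOf (d s).1 ≠ blockOf (d t).2)
    (hdself : ∀ s, blockOf (d s).1 ≠ blockOf (d s).2) :
    SecantRespecting (Finset.univ.image fun s => (blockOf (d s).1, blockOf (d s).2)) := by
  let s₀ : Fin r := ⟨0, hr⟩
  let s₁ : Fin r := ⟨r - 1, by omega⟩
  have h0 : ∀ s, s = s₀ ∨ s₀ < s := fun s => by
    rw [Fin.ext_iff, Fin.lt_def]; simp only [s₀]; omega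
  have h1 : ∀ s, s = s₁ ∨ s < s₁ := fun s => by
    have := s.isLt
    rw [Fin.ext_iff, Fin.lt_def]; simp only [s₁]; omega
  let B := blockOf (d s₀).1
  let E := blockOf (d s₁).1
  have hin : ∀ s, InArc B ((E - B).val + 1) (blockOf (d s).1) := by
    intro s
    by_contra hcon
    have hs0 : s ≠ s₀ := by
      rintro rfl
      apply hcon
      simp [InArc, B, Fin.val_sub_eq_ite]
    have hs1 : s ≠ s₁ := by
      rintro rfl
      apply hcon
      simp [InArc, E]
    have hlt0 := hdo _ _ ((h0 s).resolve_left hs0)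
    have hlt1 := hdo _ _ ((h1 s).resolve_left hs1)
    have hs01 : s₀ ≠ s₁ :=
      (((h0 s).resolve_left hs0).trans ((h1 s).resolve_left hs1)).ne
    have hbt : strictBtw (d s₁).1 (d s).1 (d s₀).1 := by
      apply strictBtw_of_blockOf
      have e0 := (hdd s s₀ hs0).1
      have e1 := (hdd s s₁ hs1).1
      have e2 := (hdd s₀ s₁ hs01).1
      rw [Ne, Fin.ext_iff] at e0 e1 e2
      rw [strictBtw_iff]
      have l0 := (blockOf (d s).1).isLt
      have l1 := (blockOf (d s₀).1).isLt
      have l2 := (blockOf (d s₁).1).isLt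
      simp only [InArc, Fin.val_sub_eq_ite, B, E] at hcon
      split_ifs at hcon <;> omega
    rw [← strictBtw_sub_right_iff _ _ _ k, strictBtw_iff] at hbt
    omega
  have hout : ∀ s, ¬ InArc B ((E - B).val + 1) (blockOf (d s).2) := by
    intro s hcon
    have hbt : strictBtw (d s₀).1 (d s).2 (d s₁).1 := by
      apply strictBtw_of_blockOf
      have hne : ∀ t, blockOf (d t).1 ≠ blockOf (d s).2 := fun t => by
        by_cases hts : t = s
        · rw [hts]; exact hdself s
        · exact (hdd t s hts).2
      have e0 := hne s₀
      have e1 := hne s₁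
      rw [Ne, Fin.ext_iff] at e0 e1
      rw [strictBtw_iff]
      have l0 := (blockOf (d s).2).isLt
      have l1 := (blockOf (d s₀).1).isLt
      have l2 := (blockOf (d s₁).1).isLt
      simp only [InArc, Fin.val_sub_eq_ite, B, E] at hcon
      split_ifs at hcon <;> omega
    rw [← strictBtw_sub_right_iff _ _ _ k, strictBtw_iff] at hbt
    rcases h0 s₁ with h | h
    · rw [h] at hbt; omega
    · have := hdo _ _ h
      rcases h1 s with rfl | h'
      · omega
      · have := hdo _ _ h'
        omega
  refine ⟨B, (E - B).val + 1, by omega, ?_, ?_⟩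
  · have := hout s₀
    simp only [InArc, not_lt] at this
    exact this.trans_lt (Fin.isLt _)
  · simp only [Finset.mem_image, Finset.mem_univ, true_and]
    rintro _ ⟨s, rfl⟩
    exact .inl ⟨hin s, hout s⟩

theorem exists_matching_of_blowup {N i : ℕ} (hN : 2 ≤ N) (hi : 0 < i) (c : Fin N → Bool)
    {M : Finset (Fin (i * N) × Fin (i * N))} (hM : IsMatching M) (hP : IsProper M)
    (hH : Heterogeneous (blowup i c) M) :
    ∃ M' : Finset (Fin N × Fin N), IsMatching M' ∧ IsProper M' ∧ Heterogeneous c M' ∧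
      M.card ≤ i * M'.card := by
  obtain ⟨hcf, k, m, hsec⟩ := hP
  obtain ⟨e, heM, heo⟩ := exists_ordered_enumeration hM hcf hsec
  have hhet : ∀ t, c (blockOf (e t).1) ≠ c (blockOf (e t).2) := fun t => by
    rcases heM t with h | h
    · exact hH _ h
    · exact (hH _ h).symm
  have hnc : ∀ s t, ¬ Crosses (e s) (e t) := by
    intro s t
    rcases heM s with h | h <;> rcases heM t with h' | h' <;>
      simpa only [crosses_swap_left_iff, crosses_swap_right_iff] using hcf _ h _ h'
  have hends : ∀ s t, s ≠ t → (e s).1 ≠ (e t).1 ∧ (e s).1 ≠ (e t).2 ∧ (e s).2 ≠ (e t).1 ∧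
      (e s).2 ≠ (e t).2 := by
    have main : ∀ s t, s < t → (e s).1 ≠ (e t).1 ∧ (e s).1 ≠ (e t).2 ∧ (e s).2 ≠ (e t).1 ∧
        (e s).2 ≠ (e t).2 := by
      intro s t hst
      have := heo s t hst
      refine ⟨?_, ?_, ?_, ?_⟩ <;> intro h <;> rw [h] at this <;> omega
    intro s t hst
    rcases lt_or_gt_of_ne hst with h | h
    · exact main s t h
    · obtain ⟨h1, h2, h3, h4⟩ := main t s h
      exact ⟨h1.symm, h3.symm, h2.symm, h4.symm⟩
  have hfar : ∀ s t, s.val + i ≤ t.val → ∀ x y, (x = (e s).1 ∨ x = (e s).2) →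
      (y = (e t).1 ∨ y = (e t).2) → blockOf x ≠ blockOf y := by
    intro s t hst x y hx hy hxy
    have htouch : ∀ g, s ≤ g → g ≤ t → ∃ z, (z = (e g).1 ∨ z = (e g).2) ∧
        blockOf z = blockOf x := by
      intro g hsg hgt
      rcases hsg.eq_or_lt with rfl | hsg
      · exact ⟨x, hx, rfl⟩
      rcases hgt.eq_or_lt with rfl | hgt
      · exact ⟨y, hy, hxy.symm⟩
      rcases blockOf_eq_of_nested (heo s g hsg) (heo g t hgt) hx hy hxy with h | h
      · exact ⟨_, .inl rfl, h⟩
      · exact ⟨_, .inr rfl, h⟩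
    have : Nonempty (Fin (i * N)) := ⟨x⟩
    choose! z hz hzx using htouch
    have hcard : (Finset.range i).card < (Finset.Icc s t).card := by
      rw [Finset.card_range, Fin.card_Icc]
      omega
    obtain ⟨g, hg, g', hg', hne, heq⟩ := Finset.exists_ne_map_eq_of_card_lt_of_maps_to hcard
      (f := fun g => (z g).val % i) (fun g _ => by simpa using Nat.mod_lt _ hi)
    rw [Finset.mem_Icc] at hg hg'
    have hzz : z g = z g' := by
      have h1 := congrArg Fin.val ((hzx g hg.1 hg.2).trans (hzx g' hg'.1 hg'.2).symm)
      simp only [blockOf] at h1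
      ext
      rw [← Nat.div_add_mod (z g).val i, ← Nat.div_add_mod (z g').val i, h1, heq]
    have := hends g g' hne
    have h1 := hz g hg.1 hg.2
    have h2 := hz g' hg'.1 hg'.2
    rw [hzz] at h1
    rcases h1 with h1 | h1 <;> rcases h2 with h2 | h2 <;> rw [h1] at h2 <;> tauto
  -- Every `i`-th pair of the list is kept.
  let r := (M.card + i - 1) / i
  have hr : ∀ s : Fin r, i * s.val < M.card := by
    intro s
    have h1 := Nat.mul_le_mul_left i (Nat.succ_le_of_lt s.isLt)
    have h2 : i * r ≤ M.card + i - 1 := Nat.mul_div_le _ _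
    rw [Nat.mul_succ] at h1
    omega
  let d : Fin r → Fin (i * N) × Fin (i * N) := fun s => e ⟨i * s.val, hr s⟩
  have hdlt : ∀ s t : Fin r, s < t → i * s.val + i ≤ i * t.val := fun s t h =>
    Nat.mul_le_mul_left i (Nat.succ_le_of_lt h)
  have hdd : ∀ s t, s ≠ t → blockOf (d s).1 ≠ blockOf (d t).1 ∧
      blockOf (d s).1 ≠ blockOf (d t).2 ∧ blockOf (d s).2 ≠ blockOf (d t).1 ∧
      blockOf (d s).2 ≠ blockOf (d t).2 := by
    have main : ∀ s t, s < t → ∀ x y, (x = (d s).1 ∨ x = (d s).2) →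
        (y = (d t).1 ∨ y = (d t).2) → blockOf x ≠ blockOf y :=
      fun s t hst => hfar _ _ (hdlt s t hst)
    intro s t hst
    rcases lt_or_gt_of_ne hst with h | h
    · have := main s t h
      exact ⟨this _ _ (.inl rfl) (.inl rfl), this _ _ (.inl rfl) (.inr rfl),
        this _ _ (.inr rfl) (.inl rfl), this _ _ (.inr rfl) (.inr rfl)⟩
    · have := main t s h
      exact ⟨(this _ _ (.inl rfl) (.inl rfl)).symm, (this _ _ (.inr rfl) (.inl rfl)).symm,
        (this _ _ (.inl rfl) (.inr rfl)).symm, (this _ _ (.inr rfl) (.inr rfl)).symm⟩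
  have hdo : ∀ s t, s < t → ((d s).1 - k).val < ((d t).1 - k).val ∧
      ((d t).1 - k).val < ((d t).2 - k).val ∧ ((d t).2 - k).val < ((d s).2 - k).val := by
    intro s t hst
    have := hdlt s t hst
    exact heo _ _ (Fin.mk_lt_mk.mpr (by omega))
  have hdself : ∀ s, blockOf (d s).1 ≠ blockOf (d s).2 := fun s h => hhet _ (congrArg c h)
  let b : Fin r → Fin N × Fin N := fun s => (blockOf (d s).1, blockOf (d s).2)
  have hbinj : Function.Injective b := fun s t h => by
    by_contra hst
    exact (hdd s t hst).1 (congrArg Prod.fst h)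
  refine ⟨Finset.univ.image b, ⟨?_, ?_⟩, ⟨?_, ?_⟩, ?_, ?_⟩
  · simp only [Finset.mem_image, Finset.mem_univ, true_and]
    rintro _ ⟨s, rfl⟩
    exact hdself s
  · simp only [Finset.mem_image, Finset.mem_univ, true_and]
    rintro _ ⟨s, rfl⟩ _ ⟨t, rfl⟩ hst
    exact hdd s t fun h => hst (by rw [h])
  · unfold CrossFree
    simp only [Finset.mem_image, Finset.mem_univ, true_and]
    rintro _ ⟨s, rfl⟩ _ ⟨t, rfl⟩ h
    exact hnc _ _ (crosses_of_blockOf h)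
  · rcases Nat.eq_zero_or_pos r with h0 | hpos
    · refine ⟨⟨0, by omega⟩, 1, one_pos, hN, ?_⟩
      simp only [Finset.mem_image, Finset.mem_univ, true_and]
      rintro _ ⟨s, rfl⟩
      exact absurd s.isLt (by omega)
    · exact secantRespecting_image_blockOf hpos hdo
        (fun s t hst => ⟨(hdd s t hst).1, (hdd s t hst).2.1⟩) hdself
  · unfold Heterogeneous
    simp only [Finset.mem_image, Finset.mem_univ, true_and]
    rintro _ ⟨s, rfl⟩
    exact hhet _
  · rw [Finset.card_image_of_injective _ hbinj, Finset.card_univ, Fintype.card_fin]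
    have h1 := Nat.div_add_mod (M.card + i - 1) i
    have h2 := Nat.mod_lt (M.card + i - 1) hi
    change M.card ≤ i * ((M.card + i - 1) / i)
    omega

theorem monoCount_blowup {N i : ℕ} (hi : 0 < i) (c : Fin N → Bool) :
    monoCount (blowup i c) = monoCount c := by
  let last : Fin i := ⟨i - 1, by omega⟩
  have hnext : ∀ a : Fin N, (i * a.val + (i - 1) + 1) % (i * N) / i = (a.val + 1) % N := by
    intro a
    rw [show i * a.val + (i - 1) + 1 = i * (a.val + 1) by rw [Nat.mul_succ]; omega,
      Nat.mul_mod_mul_left, Nat.mul_div_cancel_left _ hi]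
  symm
  unfold monoCount
  refine Finset.card_bij (fun a _ => beadOf a last) ?_ ?_ ?_
  · intro a ha
    rw [Finset.mem_filter] at ha ⊢
    refine ⟨Finset.mem_univ _, ?_⟩
    change c (blockOf (beadOf a last)) ≠ c ⟨(i * a.val + (i - 1) + 1) % (i * N) / i, _⟩
    simp only [hnext, blockOf_beadOf]
    exact ha.2
  · intro a _ a' _ h
    exact (beadOf_injective h).1
  · intro x hx
    rw [Finset.mem_filter] at hx
    have hdm := Nat.div_add_mod x.val i
    have hmod := Nat.mod_lt x.val hi
    have hxl := x.isLt
    by_cases hlast : x.val % i = i - 1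
    · have hx' : x = beadOf (blockOf x) last := by
        ext
        simp only [beadOf, blockOf, last]
        omega
      refine ⟨blockOf x, ?_, hx'.symm⟩
      rw [Finset.mem_filter]
      refine ⟨Finset.mem_univ _, ?_⟩
      have h := hx.2
      rw [hx'] at h
      change c (blockOf (beadOf _ last)) ≠
        c ⟨(i * (blockOf x).val + (i - 1) + 1) % (i * N) / i, _⟩ at h
      simpa only [hnext, blockOf_beadOf] using h
    · exfalso
      apply hx.2
      have hlt : x.val + 1 < i * N := by
        have h1 := Nat.mul_le_mul_left i (Nat.succ_le_of_lt (blockOf x).isLt)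
        rw [Nat.mul_succ] at h1
        simp only [blockOf] at h1
        omega
      have hq : (x.val + 1) / i = x.val / i := by
        rw [Nat.div_eq_iff hi, mul_comm]
        omega
      simp only [blowup, Nat.mod_eq_of_lt hlt, hq]

theorem bddAbove_matching_sizes {N : ℕ} (P : Finset (Fin N × Fin N) → Prop) :
    BddAbove {k : ℕ | ∃ M : Finset (Fin N × Fin N), IsMatching M ∧ IsProper M ∧ P M ∧
      2 * M.card = k} := by
  refine ⟨2 * Fintype.card (Fin N × Fin N), ?_⟩
  rintro _ ⟨M, -, -, -, rfl⟩
  exact Nat.mul_le_mul_left 2 M.card_le_univ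

theorem sSup_matching_sizes_blowup {N i : ℕ} (hN : 2 ≤ N) (hi : 0 < i) (c : Fin N → Bool) :
    sSup {k : ℕ | ∃ M : Finset (Fin (i * N) × Fin (i * N)),
        IsMatching M ∧ IsProper M ∧ Heterogeneous (blowup i c) M ∧ 2 * M.card = k}
      = i * sSup {k : ℕ | ∃ M : Finset (Fin N × Fin N),
        IsMatching M ∧ IsProper M ∧ Heterogeneous c M ∧ 2 * M.card = k} := by
  have hne : {k : ℕ | ∃ M : Finset (Fin N × Fin N),
      IsMatching M ∧ IsProper M ∧ Heterogeneous c M ∧ 2 * M.card = k}.Nonempty :=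
    ⟨0, ∅, by simp [IsMatching], ⟨by simp [CrossFree], ⟨0, by omega⟩, 1, one_pos, hN, by simp⟩,
      by simp [Heterogeneous], by simp⟩
  obtain ⟨M, hM, hP, hH, hcard⟩ := Nat.sSup_mem hne (bddAbove_matching_sizes (Heterogeneous c))
  obtain ⟨M', hM', hP', hH', hcard'⟩ := exists_blowup_matching hi c hM hP hH
  apply le_antisymm
  · refine csSup_le ⟨_, M', hM', hP', hH', rfl⟩ ?_
    rintro _ ⟨Q, hQ, hQP, hQH, rfl⟩
    obtain ⟨R, hR, hRP, hRH, hle⟩ := exists_matching_of_blowup hN hi c hQ hQP hQH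
    calc 2 * Q.card ≤ 2 * (i * R.card) := Nat.mul_le_mul_left 2 hle
      _ = i * (2 * R.card) := by ring
      _ ≤ _ := Nat.mul_le_mul_left i
        (le_csSup (bddAbove_matching_sizes _) ⟨R, hR, hRP, hRH, rfl⟩)
  · refine le_csSup (bddAbove_matching_sizes _) ⟨M', hM', hP', hH', ?_⟩
    rw [hcard', ← hcard]
    ring

/-- blowing up each bead of a balanced necklace L into i ≥ 1
consecutive beads of the same color multiplies the maximum number of beads
covered by a proper heterogeneous matching by i, and preserves mono(L). -/
theorem stmt12 (n : ℕ) (c : Fin (2 * n) → Bool) (hbal : redCount c = n)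
    (i : ℕ) (hi : 1 ≤ i) :
    sSup {k : ℕ | ∃ M : Finset (Fin (i * (2 * n)) × Fin (i * (2 * n))),
        IsMatching M ∧ IsProper M ∧ Heterogeneous (blowup i c) M ∧ 2 * M.card = k}
      = i * sSup {k : ℕ | ∃ M : Finset (Fin (2 * n) × Fin (2 * n)),
        IsMatching M ∧ IsProper M ∧ Heterogeneous c M ∧ 2 * M.card = k}
    ∧ monoCount (blowup i c) = monoCount c := by
  refine ⟨?_, monoCount_blowup hi c⟩
  rcases Nat.eq_zero_or_pos n with rfl | hn
  · have hempty : ∀ (N : ℕ), N = 0 → ∀ c : Fin N → Bool, {k : ℕ | ∃ M : Finset (Fin N × Fin N),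
        IsMatching M ∧ IsProper M ∧ Heterogeneous c M ∧ 2 * M.card = k} = ∅ := by
      rintro N rfl c
      rw [Set.eq_empty_iff_forall_notMem]
      rintro k ⟨M, -, ⟨-, k, -⟩, -⟩
      exact k.elim0
    rw [hempty _ (by simp), hempty _ (by simp)]
    simp
  · exact sSup_matching_sizes_blowup (by omega) hi c
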